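/- Let Q : ℝⁿ → [0,∞) be a C¹ function, σ > 0 and r > 0, define V : C⁰([−r,0];ℝⁿ) → [0,∞) by V(x) := max_{θ∈[−r,0]} e^{2σθ}·Q(x(θ)), and define V⁰(x;v) := limsup_{h→0⁺} (V(E_h(x;v)) − V(x))/h for x ∈ C⁰([−r,0];ℝⁿ) and v ∈ ℝⁿ. Then: (i) if Q(x(0)) < V(x), then V⁰(x;v) ≤ −2σ·V(x) for every v ∈ ℝⁿ; (ii) if Q(x(0)) = V(x), then V⁰(x;v) ≤ max{ −2σ·V(x), ∇Q(x(0))·v } for every v ∈ ℝⁿ. -/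

import Mathlib

open Filter Topology MeasureTheory Set RealInnerProductSpace

noncomputable section

/-- ℝⁿ with the Euclidean norm. -/
abbrev Euc (n : ℕ) := EuclideanSpace ℝ (Fin n)

/-- The state space C⁰([−r,0];ℝⁿ) with the sup norm. -/
abbrev Hist (n : ℕ) (r : ℝ) := C(Icc (-r) (0:ℝ), Euc n)

/-- Class K∞ functions (on [0,∞)). -/
def IsKinf (a : ℝ → ℝ) : Prop :=
  ContinuousOn a (Ici 0) ∧ StrictMonoOn a (Ici 0) ∧ a 0 = 0 ∧ Tendsto a atTop atTop

/-- Class K⁺: positive continuous functions on [0,∞). -/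
def IsKplus (b : ℝ → ℝ) : Prop := ContinuousOn b (Ici 0) ∧ ∀ t, 0 ≤ t → 0 < b t

/-- Class ℰ: continuous nonnegative integrable functions on [0,∞) tending to 0. -/
def IsClassE (q : ℝ → ℝ) : Prop :=
  ContinuousOn q (Ici 0) ∧ (∀ t, 0 ≤ t → 0 ≤ q t) ∧
    IntegrableOn q (Ici 0) ∧ Tendsto q atTop (𝓝 0)

/-- Continuous positive definite functions on [0,∞). -/
def IsPosDef (ρ : ℝ → ℝ) : Prop :=
  ContinuousOn ρ (Ici 0) ∧ ρ 0 = 0 ∧ (∀ s, 0 < s → 0 < ρ s) ∧ ∀ s, 0 ≤ s → 0 ≤ ρ s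

/-- Membership in M_D : measurable selections of values in D. -/
def InMD {l : ℕ} (D : Set (Euc l)) (d : ℝ → Euc l) : Prop :=
  Measurable d ∧ ∀ t, d t ∈ D

/-- The operator E_h(x;v) of Section 4.II: E_h(x;v)(θ) = x(0)+(θ+h)v for −h < θ ≤ 0 and
E_h(x;v)(θ) = x(θ+h) for −r ≤ θ ≤ −h. -/
def Ehist {n : ℕ} {r : ℝ} (h : ℝ) (x : Hist n r) (v : Euc n) : Hist n r :=
  if hr : -r ≤ 0 then
    { toFun := fun θ => if (θ : ℝ) ≤ -h then x (projIcc (-r) 0 hr ((θ : ℝ) + h))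
        else x (projIcc (-r) 0 hr 0) + ((θ : ℝ) + h) • v
      continuous_toFun := by
        apply Continuous.if_le
        · exact x.continuous.comp (continuous_projIcc.comp (by fun_prop))
        · exact continuous_const.add ((continuous_subtype_val.add continuous_const).smul
            continuous_const)
        · exact continuous_subtype_val
        · exact continuous_const
        · intro θ hθ
          rw [hθ]
          simp }
  else x

/-- The Dini derivative V⁰(t,x;v) of a functional V : [0,∞)×C⁰([−r,0];ℝⁿ) → ℝ:
V⁰(t,x;v) := limsup_{h→0⁺, y→0} (V(t+h, E_h(x;v)+h·y) − V(t,x))/h. -/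
def diniH {n : ℕ} {r : ℝ} (V : ℝ → Hist n r → ℝ) (t : ℝ) (x : Hist n r) (v : Euc n) :
    EReal :=
  Filter.limsup
    (fun p : ℝ × Hist n r =>
      (((V (t + p.1) (Ehist p.1 x v + p.1 • p.2) - V t x) / p.1 : ℝ) : EReal))
    ((𝓝[>] (0:ℝ)) ×ˢ 𝓝 0)

/-- The simplified Dini derivative V⁰(x;v) := limsup_{h→0⁺} (V(E_h(x;v)) − V(x))/h of a
time-independent functional. -/
def diniH0 {n : ℕ} {r : ℝ} (V : Hist n r → ℝ) (x : Hist n r) (v : Euc n) : EReal :=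
  Filter.limsup (fun h : ℝ => (((V (Ehist h x v) - V x) / h : ℝ) : EReal)) (𝓝[>] (0:ℝ))

/-- x : [t₀−r, tmax) → ℝⁿ (with history map φ) is a solution of the RFDE
ẋ(t) = F(t,d(t),T_r(t)x) with initial condition T_r(t₀)x = x₀, in integral form. -/
def IsSolutionRFDE {n l : ℕ} {r : ℝ} (F : ℝ → Euc l → Hist n r → Euc n)
    (d : ℝ → Euc l) (t₀ : ℝ) (x₀ : Hist n r) (tmax : EReal) (x : ℝ → Euc n)
    (φ : ℝ → Hist n r) : Prop :=
  (t₀ : EReal) < tmax ∧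
  φ t₀ = x₀ ∧
  (∀ t : ℝ, t₀ ≤ t → (t : EReal) < tmax → ∀ θ : Icc (-r) (0:ℝ), φ t θ = x (t + θ)) ∧
  ContinuousOn x {s : ℝ | t₀ - r ≤ s ∧ (s : EReal) < tmax} ∧
  (∀ t : ℝ, t₀ ≤ t → (t : EReal) < tmax → x t = x t₀ + ∫ s in t₀..t, F s (d s) (φ s))

/-- A functional V : [0,∞)×C⁰([−r,0];ℝⁿ) → [0,∞) which is
"almost Lipschitz on bounded sets" (Definition 4.5). -/
def AlmostLipschitzOn {n : ℕ} (r : ℝ) (V : ℝ → Hist n r → ℝ) : Prop :=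
  ContinuousOn (fun p : ℝ × Hist n r => V p.1 p.2) (Ici 0 ×ˢ univ) ∧
  ∃ LV P G : ℝ → ℝ, Monotone LV ∧ Monotone P ∧ Monotone G ∧ (∀ s, 1 ≤ G s) ∧
    (∀ R, 0 ≤ R → ∀ t ∈ Icc (0:ℝ) R, ∀ x y : Hist n r, ‖x‖ ≤ R → ‖y‖ ≤ R →
      |V t y - V t x| ≤ LV R * ‖y - x‖) ∧
    (∀ R, 0 ≤ R → ∀ M : ℝ, 0 ≤ M → ∀ x : Hist n r, ‖x‖ ≤ R →
      LipschitzWith (Real.toNNReal M) (fun θ : Icc (-r) (0:ℝ) => x θ) →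
      ∀ t ∈ Icc (0:ℝ) R, ∀ h : ℝ, 0 ≤ h → h ≤ 1 / G (R + M) →
        |V (t + h) x - V t x| ≤ h * P R * (1 + M))

/-- RGAOS (Definition 4.2) of the system ẋ(t) = F(t,d(t),T_r(t)x), Y(t) = H(t,T_r(t)x),
phrased via the existence of a family of unique maximal solutions satisfying robust
forward completeness and properties P1, P2. -/
def RGAOSrfde {n l : ℕ} {Y : Type*} [NormedAddCommGroup Y] [NormedSpace ℝ Y] (r : ℝ)
    (D : Set (Euc l)) (F : ℝ → Euc l → Hist n r → Euc n) (H : ℝ → Hist n r → Y) : Prop :=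
  ∃ (X : ℝ → Hist n r → (ℝ → Euc l) → ℝ → Euc n)
    (Φ : ℝ → Hist n r → (ℝ → Euc l) → ℝ → Hist n r)
    (tmax : ℝ → Hist n r → (ℝ → Euc l) → EReal),
    (∀ t₀ : ℝ, 0 ≤ t₀ → ∀ x₀ d, InMD D d →
      IsSolutionRFDE F d t₀ x₀ (tmax t₀ x₀ d) (X t₀ x₀ d) (Φ t₀ x₀ d) ∧
      ∀ tm y ψ, IsSolutionRFDE F d t₀ x₀ tm y ψ → tm ≤ tmax t₀ x₀ d ∧
        ∀ t : ℝ, t₀ ≤ t → (t : EReal) < tm → ψ t = Φ t₀ x₀ d t) ∧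
    -- robust forward completeness
    (∀ T, 0 ≤ T → ∀ s, 0 ≤ s → ∃ M, ∀ t₀ ∈ Icc (0:ℝ) T, ∀ ξ ∈ Icc (0:ℝ) T,
      ∀ x₀ : Hist n r, ‖x₀‖ ≤ s → ∀ d, InMD D d →
        ((t₀ + ξ : ℝ) : EReal) < tmax t₀ x₀ d ∧ ‖Φ t₀ x₀ d (t₀ + ξ)‖ ≤ M) ∧
    -- P1 (output stability)
    (∀ ε, 0 < ε → ∀ T, 0 ≤ T →
      (∃ M, ∀ t₀ ∈ Icc (0:ℝ) T, ∀ x₀ : Hist n r, ‖x₀‖ ≤ ε → ∀ d, InMD D d →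
        ∀ t : ℝ, t₀ ≤ t → (t : EReal) < tmax t₀ x₀ d → ‖H t (Φ t₀ x₀ d t)‖ ≤ M) ∧
      (∃ δ, 0 < δ ∧ ∀ t₀ ∈ Icc (0:ℝ) T, ∀ x₀ : Hist n r, ‖x₀‖ ≤ δ → ∀ d, InMD D d →
        ∀ t : ℝ, t₀ ≤ t → (t : EReal) < tmax t₀ x₀ d → ‖H t (Φ t₀ x₀ d t)‖ ≤ ε)) ∧
    -- P2 (uniform output attractivity on bounded sets of initial data)
    (∀ ε, 0 < ε → ∀ T, 0 ≤ T → ∀ R, 0 ≤ R → ∃ τ, 0 ≤ τ ∧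
      ∀ t₀ ∈ Icc (0:ℝ) T, ∀ x₀ : Hist n r, ‖x₀‖ ≤ R → ∀ d, InMD D d →
        ∀ t : ℝ, t₀ + τ ≤ t → (t : EReal) < tmax t₀ x₀ d → ‖H t (Φ t₀ x₀ d t)‖ ≤ ε)

/-- URGAOS (Definition 4.3) of the system ẋ(t) = F(t,d(t),T_r(t)x), Y(t) = H(t,T_r(t)x). -/
def URGAOSrfde {n l : ℕ} {Y : Type*} [NormedAddCommGroup Y] [NormedSpace ℝ Y] (r : ℝ)
    (D : Set (Euc l)) (F : ℝ → Euc l → Hist n r → Euc n) (H : ℝ → Hist n r → Y) : Prop :=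
  ∃ (X : ℝ → Hist n r → (ℝ → Euc l) → ℝ → Euc n)
    (Φ : ℝ → Hist n r → (ℝ → Euc l) → ℝ → Hist n r)
    (tmax : ℝ → Hist n r → (ℝ → Euc l) → EReal),
    (∀ t₀ : ℝ, 0 ≤ t₀ → ∀ x₀ d, InMD D d →
      IsSolutionRFDE F d t₀ x₀ (tmax t₀ x₀ d) (X t₀ x₀ d) (Φ t₀ x₀ d) ∧
      ∀ tm y ψ, IsSolutionRFDE F d t₀ x₀ tm y ψ → tm ≤ tmax t₀ x₀ d ∧
        ∀ t : ℝ, t₀ ≤ t → (t : EReal) < tm → ψ t = Φ t₀ x₀ d t) ∧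
    (∀ T, 0 ≤ T → ∀ s, 0 ≤ s → ∃ M, ∀ t₀ ∈ Icc (0:ℝ) T, ∀ ξ ∈ Icc (0:ℝ) T,
      ∀ x₀ : Hist n r, ‖x₀‖ ≤ s → ∀ d, InMD D d →
        ((t₀ + ξ : ℝ) : EReal) < tmax t₀ x₀ d ∧ ‖Φ t₀ x₀ d (t₀ + ξ)‖ ≤ M) ∧
    (∀ ε, 0 < ε →
      (∃ M, ∀ t₀ : ℝ, 0 ≤ t₀ → ∀ x₀ : Hist n r, ‖x₀‖ ≤ ε → ∀ d, InMD D d →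
        ∀ t : ℝ, t₀ ≤ t → (t : EReal) < tmax t₀ x₀ d → ‖H t (Φ t₀ x₀ d t)‖ ≤ M) ∧
      (∃ δ, 0 < δ ∧ ∀ t₀ : ℝ, 0 ≤ t₀ → ∀ x₀ : Hist n r, ‖x₀‖ ≤ δ → ∀ d, InMD D d →
        ∀ t : ℝ, t₀ ≤ t → (t : EReal) < tmax t₀ x₀ d → ‖H t (Φ t₀ x₀ d t)‖ ≤ ε)) ∧
    (∀ ε, 0 < ε → ∀ R, 0 ≤ R → ∃ τ, 0 ≤ τ ∧
      ∀ t₀ : ℝ, 0 ≤ t₀ → ∀ x₀ : Hist n r, ‖x₀‖ ≤ R → ∀ d, InMD D d →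
        ∀ t : ℝ, t₀ + τ ≤ t → (t : EReal) < tmax t₀ x₀ d → ‖H t (Φ t₀ x₀ d t)‖ ≤ ε)

/-- The functional V(x) := max_{θ∈[−r,0]} e^{2σθ}·Q(x(θ)) of Lemma 5.3. -/
def Vmax {n : ℕ} (r σ : ℝ) (Q : Euc n → ℝ) (x : Hist n r) : ℝ :=
  ⨆ θ : Icc (-r) (0:ℝ), Real.exp (2 * σ * (θ : ℝ)) * Q (x θ)

lemma aux_bdd {n : ℕ} (r σ : ℝ) (Q : Euc n → ℝ) (hQ : Continuous Q) (x : Hist n r) :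
    BddAbove (range fun θ : Icc (-r) (0:ℝ) => Real.exp (2 * σ * (θ : ℝ)) * Q (x θ)) := by
  apply IsCompact.bddAbove
  apply isCompact_range
  have := x.continuous
  fun_prop

lemma aux_main {n : ℕ} (r σ : ℝ) (hr : 0 < r) (hσ : 0 < σ)
    (Q : Euc n → ℝ) (hQ : Continuous Q) (x : Hist n r) (v : Euc n) (x0 : Euc n)
    (hx0 : x ⟨0, ⟨by linarith, le_rfl⟩⟩ = x0) (M : ℝ)
    (hM : -(2 * σ) * Vmax r σ Q x ≤ M)
    (H : ∀ ε : ℝ, 0 < ε → ∀ᶠ s in 𝓝[>] (0:ℝ), Real.exp (2 * σ * s) * Q (x0 + s • v) ≤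
      Vmax r σ Q x + s * (2 * σ * Vmax r σ Q x + M + ε)) :
    diniH0 (Vmax r σ Q) x v ≤ (M : EReal) := by
  rw [← EReal.le_of_forall_lt_iff_le]
  intro c hc
  have hc' : M < c := by exact_mod_cast hc
  set V := Vmax r σ Q x with hV
  set ε := (c - M) / 2 with hε
  have hεpos : 0 < ε := by rw [hε]; linarith
  set K := 2 * σ * V + M + ε with hK
  have hKpos : 0 ≤ K := by rw [hK]; linarith
  have hder : HasDerivAt (fun h : ℝ => Real.exp (-(2 * σ) * h) * (V + h * K)) (M + ε) 0 := by
    have h1 : HasDerivAt (fun h : ℝ => Real.exp (-(2 * σ) * h))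
        (Real.exp (-(2 * σ) * 0) * (-(2 * σ) * 1)) 0 :=
      ((hasDerivAt_id (0:ℝ)).const_mul (-(2 * σ))).exp
    have h2 : HasDerivAt (fun h : ℝ => V + h * K) (1 * K) 0 :=
      ((hasDerivAt_id (0:ℝ)).mul_const K).const_add V
    have h3 : M + ε = Real.exp (-(2 * σ) * 0) * (-(2 * σ) * 1) * (V + 0 * K)
        + Real.exp (-(2 * σ) * 0) * (1 * K) := by
      simp only [mul_zero, Real.exp_zero, hK]
      ring
    rw [h3]
    exact h1.mul h2
  have hslope := hder.tendsto_slope_zero_right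
  have hev : ∀ᶠ h in 𝓝[>] (0:ℝ), h⁻¹ • (Real.exp (-(2 * σ) * (0 + h)) * (V + (0 + h) * K)
      - Real.exp (-(2 * σ) * 0) * (V + 0 * K)) < c :=
    hslope.eventually (gt_mem_nhds (by rw [hε]; linarith))
  obtain ⟨δ, hδ, hHδ⟩ := mem_nhdsGT_iff_exists_Ioo_subset.1 (H ε hεpos)
  have hδ' : (0:ℝ) < δ := hδ
  have hsmall : ∀ᶠ h in 𝓝[>] (0:ℝ), h ∈ Ioo (0:ℝ) (min δ r) :=
    Ioo_mem_nhdsGT (lt_min hδ' hr)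
  unfold diniH0
  refine limsup_le_of_le (by isBoundedDefault) ?_
  filter_upwards [hev, hsmall] with h h1 h2
  obtain ⟨hpos, hlt⟩ := h2
  have hhδ : h < δ := hlt.trans_le (min_le_left _ _)
  have hhr : h < r := hlt.trans_le (min_le_right _ _)
  have hbound : Vmax r σ Q (Ehist h x v) ≤ Real.exp (-(2 * σ) * h) * (V + h * K) := by
    have : Nonempty (Icc (-r) (0:ℝ)) := ⟨⟨0, by linarith, le_rfl⟩⟩
    apply ciSup_le
    rintro ⟨θ, hθ1, hθ2⟩
    have hr0 : -r ≤ 0 := by linarith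
    have hE := Real.exp_pos (-(2 * σ) * h)
    have hexp : Real.exp (2 * σ * θ) = Real.exp (-(2 * σ) * h) * Real.exp (2 * σ * (θ + h)) := by
      rw [← Real.exp_add]; congr 1; ring
    simp only [Ehist, hr0, dif_pos, ContinuousMap.coe_mk]
    rw [hexp, mul_assoc]
    apply mul_le_mul_of_nonneg_left _ hE.le
    split_ifs with hc
    · have hm : θ + h ∈ Icc (-r) (0:ℝ) := ⟨by linarith, by linarith⟩
      rw [projIcc_of_mem hr0 hm]
      have := le_ciSup (aux_bdd r σ Q hQ x) ⟨θ + h, hm⟩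
      have h3 : Real.exp (2 * σ * (θ + h)) * Q (x ⟨θ + h, hm⟩) ≤ V := this
      have h4 : 0 ≤ h * K := by positivity
      linarith
    · have h0 : (0:ℝ) ∈ Icc (-r) (0:ℝ) := ⟨hr0, le_rfl⟩
      rw [projIcc_of_mem hr0 h0, hx0]
      push Not at hc
      have h3 : Real.exp (2 * σ * (θ + h)) * Q (x0 + (θ + h) • v) ≤ V + (θ + h) * K :=
        hHδ ⟨by linarith, by linarith⟩
      have h4 : (θ + h) * K ≤ h * K := mul_le_mul_of_nonneg_right (by linarith) hKpos
      linarith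
  have : (Vmax r σ Q (Ehist h x v) - V) / h ≤ c := by
    refine le_trans ?_ h1.le
    rw [smul_eq_mul, inv_mul_eq_div]
    apply div_le_div_of_nonneg_right _ hpos.le
    simp only [zero_add, mul_zero, Real.exp_zero, zero_mul, add_zero, one_mul]
    linarith
  exact_mod_cast this

/-- Lemma 5.3, second assertion (inequalities (5.6a), (5.6b)): with
V⁰(x;v) = limsup_{h→0⁺} (V(E_h(x;v)) − V(x))/h, one has V⁰(x;v) ≤ −2σV(x) whenever
Q(x(0)) < V(x), and V⁰(x;v) ≤ max{−2σV(x), ∇Q(x(0))·v} whenever Q(x(0)) = V(x). -/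
theorem stmt17 {n : ℕ} (r σ : ℝ) (hr : 0 < r) (hσ : 0 < σ)
    (Q : Euc n → ℝ) (hQ : ContDiff ℝ 1 Q) (hQpos : ∀ y, 0 ≤ Q y) :
    (∀ (x : Hist n r) (v : Euc n),
      Q (x ⟨0, ⟨by linarith, le_rfl⟩⟩) < Vmax r σ Q x →
      diniH0 (Vmax r σ Q) x v ≤ ((-(2 * σ) * Vmax r σ Q x : ℝ) : EReal)) ∧
    (∀ (x : Hist n r) (v : Euc n),
      Q (x ⟨0, ⟨by linarith, le_rfl⟩⟩) = Vmax r σ Q x →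
      diniH0 (Vmax r σ Q) x v ≤
        ((max (-(2 * σ) * Vmax r σ Q x)
          (fderiv ℝ Q (x ⟨0, ⟨by linarith, le_rfl⟩⟩) v) : ℝ) : EReal)) := by
  constructor
  · intro x v hlt
    refine aux_main r σ hr hσ Q hQ.continuous x v _ rfl _ le_rfl ?_
    intro ε hε
    set x0 := x ⟨0, ⟨by linarith, le_rfl⟩⟩ with hx0
    have hcont : Continuous fun s : ℝ => Real.exp (2 * σ * s) * Q (x0 + s • v) := by
      have := hQ.continuous
      fun_prop
    have h1 : ∀ᶠ s in 𝓝 (0:ℝ), Real.exp (2 * σ * s) * Q (x0 + s • v) < Vmax r σ Q x :=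
      hcont.continuousAt.eventually (gt_mem_nhds (by simpa using hlt))
    filter_upwards [h1.filter_mono nhdsWithin_le_nhds, self_mem_nhdsWithin] with s hs hpos
    have hpos' : (0:ℝ) < s := hpos
    have : 0 < s * ε := by positivity
    calc _ ≤ Vmax r σ Q x := hs.le
      _ ≤ Vmax r σ Q x + s * ε := by linarith
      _ = _ := by ring
  · intro x v heq
    refine aux_main r σ hr hσ Q hQ.continuous x v _ rfl _ (le_max_left _ _) ?_
    intro ε hε
    set x0 := x ⟨0, ⟨by linarith, le_rfl⟩⟩ with hx0
    set M := max (-(2 * σ) * Vmax r σ Q x) (fderiv ℝ Q x0 v) with hM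
    have hqM : fderiv ℝ Q x0 v ≤ M := le_max_right _ _
    have h1 : HasDerivAt (fun s : ℝ => Real.exp (2 * σ * s))
        (Real.exp (2 * σ * 0) * (2 * σ * 1)) 0 :=
      ((hasDerivAt_id (0:ℝ)).const_mul (2 * σ)).exp
    have h2 : HasDerivAt (fun s : ℝ => Q (x0 + s • v)) (fderiv ℝ Q x0 v) 0 := by
      have hd : HasFDerivAt Q (fderiv ℝ Q x0) x0 :=
        (hQ.differentiable (by norm_num) x0).hasFDerivAt
      exact hd.hasLineDerivAt v
    have h3 := (h1.mul h2).tendsto_slope_zero_right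
    have h5 : Real.exp (2 * σ * 0) * (2 * σ * 1) * Q (x0 + (0:ℝ) • v)
        + Real.exp (2 * σ * 0) * fderiv ℝ Q x0 v < 2 * σ * Vmax r σ Q x + M + ε := by
      simp only [mul_zero, Real.exp_zero, zero_smul, add_zero, one_mul, mul_one, heq]
      linarith
    have h4 := h3.eventually (gt_mem_nhds h5)
    filter_upwards [h4, self_mem_nhdsWithin] with s hs hpos
    have hpos' : (0:ℝ) < s := hpos
    simp only [Pi.mul_apply, zero_add, mul_zero, Real.exp_zero, zero_smul, add_zero, one_mul,
      heq, smul_eq_mul] at hs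
    rw [inv_mul_lt_iff₀ hpos'] at hs
    linarith
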